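/- Refined subordinate partition of unity (Lemma 4.4). Let K ⊂ ℝⁿ be compact and let U₀, …, U_I be open subsets of ℝⁿ covering K. Then there exist finitely many smooth functions ϱ₁, …, ϱ_J : ℝⁿ → [0,1], each with compact support, such that: (i) Σ_{j=1}^J ϱ_j(x) = 1 for every x ∈ K; (ii) for each j there is an i with supp ϱ_j ⊆ U_i; (iii) for every pair (k, l) with 1 ≤ k, l ≤ J, either there exists an i with supp ϱ_k ∪ supp ϱ_l ⊆ U_i, or supp ϱ_k ∩ supp ϱ_l = ∅. -/

import Mathlib

open Set

open scoped Manifold ContDiff in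
/-- A compact set in a finite-dimensional normed space admits a finite smooth partition of unity
whose members are supported in balls of any prescribed radius `r`, centred at points of the set. -/
theorem IsCompact.exists_smoothPartitionOfUnity_tsupport_subset_ball {E : Type*}
    [NormedAddCommGroup E] [NormedSpace ℝ E] [FiniteDimensional ℝ E] {K : Set E}
    (hK : IsCompact K) {r : ℝ} (hr : 0 < r) :
    ∃ t : Finset E, (t : Set E) ⊆ K ∧
      ∃ f : SmoothPartitionOfUnity t 𝓘(ℝ, E) E K, ∀ c : t, tsupport (f c) ⊆ Metric.ball (c : E) r := by
  obtain ⟨t, htK, ht, hcover⟩ := hK.finite_cover_balls hr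
  lift t to Finset E using ht
  refine ⟨t, htK, SmoothPartitionOfUnity.exists_isSubordinate 𝓘(ℝ, E) hK.isClosed
    (fun c : t => Metric.ball (c : E) r) (fun _ => Metric.isOpen_ball) ?_⟩
  intro x hx
  obtain ⟨c, hc, hxc⟩ := mem_iUnion₂.1 (hcover hx)
  exact mem_iUnion.2 ⟨⟨c, hc⟩, hxc⟩

/-- Refined subordinate partition of unity (Lemma 4.4): given a compact `K ⊆ ℝⁿ`
covered by finitely many open sets `U₀, …, U_I`, there is a finite smooth partition
of unity `ϱ₁, …, ϱ_J` on `K`, with values in `[0,1]` and compact supports, each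
supported in some `U_i`, and such that any two of the functions either have their
supports jointly contained in a single `U_i`, or have disjoint supports. -/
theorem refined_subordinate_partition_of_unity (n I : ℕ)
    (K : Set (EuclideanSpace ℝ (Fin n))) (hK : IsCompact K)
    (U : Fin (I + 1) → Set (EuclideanSpace ℝ (Fin n)))
    (hU : ∀ i, IsOpen (U i)) (hcover : K ⊆ ⋃ i, U i) :
    ∃ (J : ℕ) (ϱ : Fin J → EuclideanSpace ℝ (Fin n) → ℝ),
      (∀ j, ContDiff ℝ (⊤ : ℕ∞) (ϱ j)) ∧
      (∀ j, HasCompactSupport (ϱ j)) ∧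
      (∀ j x, ϱ j x ∈ Icc (0 : ℝ) 1) ∧
      (∀ x ∈ K, ∑ j, ϱ j x = 1) ∧
      (∀ j, ∃ i, tsupport (ϱ j) ⊆ U i) ∧
      (∀ k l, (∃ i, tsupport (ϱ k) ∪ tsupport (ϱ l) ⊆ U i) ∨
        tsupport (ϱ k) ∩ tsupport (ϱ l) = ∅) := by
  obtain ⟨δ, hδ, hball⟩ := lebesgue_number_lemma_of_metric hK hU hcover
  obtain ⟨t, htK, f, hf⟩ :=
    hK.exists_smoothPartitionOfUnity_tsupport_subset_ball (r := δ / 4) (by positivity)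
  let e := t.equivFin.symm
  refine ⟨t.card, fun j => f (e j), fun j => (f (e j)).contMDiff.contDiff, fun j => ?_,
    fun j x => ⟨f.nonneg _ x, f.le_one _ x⟩, fun x hx => ?_, fun j => ?_, fun k l => ?_⟩
  · exact Metric.isCompact_of_isClosed_isBounded (isClosed_tsupport _)
      (Metric.isBounded_ball.subset (hf (e j)))
  · rw [e.sum_comp (fun c => f c x), ← finsum_eq_sum_of_fintype]
    exact f.sum_eq_one hx
  · obtain ⟨i, hi⟩ := hball _ (htK (e j).2)
    exact ⟨i, (hf (e j)).trans ((Metric.ball_subset_ball (by linarith)).trans hi)⟩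
  · refine or_iff_not_imp_right.2 fun hne => ?_
    obtain ⟨y, hyk, hyl⟩ := nonempty_iff_ne_empty.2 hne
    obtain ⟨i, hi⟩ := hball _ (htK (e k).2)
    refine ⟨i, (union_subset ((hf (e k)).trans (Metric.ball_subset_ball (by linarith)))
      fun z hz => ?_).trans hi⟩
    have hyk' := Metric.mem_ball.1 (hf _ hyk)
    have hyl' := Metric.mem_ball'.1 (hf _ hyl)
    have hzl := Metric.mem_ball.1 (hf _ hz)
    rw [Metric.mem_ball]
    linarith [dist_triangle4 z (e l) y (e k)]
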